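/- Let K be a weakly self-similar compact metric space. Then for the generic f ∈ C(K), for every y ∈ int f(K) one has dim_H f⁻¹(y) = dim_tH K − 1. -/

import Mathlib

open MeasureTheory Topology Metric Set
open scoped Classical

/-- Hausdorff dimension of a subset of a metric space, as an extended real number, with the
convention that the empty set has dimension `-1`. -/
noncomputable def hdim {X : Type*} [EMetricSpace X] (s : Set X) : EReal :=
  if s = ∅ then -1 else (dimH s : EReal)

/-- The topological Hausdorff dimension of a metric space `X`:
`dim_tH X = inf {d : X has a basis 𝒰 such that dim_H ∂U ≤ d − 1 for every U ∈ 𝒰}`, with the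
convention `dim_tH ∅ = -1` (the infimum of the empty set of extended reals being `⊤`). -/
noncomputable def tHdim (X : Type*) [MetricSpace X] : EReal :=
  if Nonempty X then
    sInf {d : EReal | ∃ 𝒰 : Set (Set X), TopologicalSpace.IsTopologicalBasis 𝒰 ∧
      ∀ U ∈ 𝒰, hdim (frontier U) ≤ d - 1}
  else -1

/-- `A` admits a countable open cover whose total `s`-dimensional size is less than `η`. -/
def HasSmallCover {X : Type*} [MetricSpace X] (s : NNReal) (η : ENNReal) (A : Set X) : Prop :=
  ∃ t : ℕ → Set X, (∀ n, IsOpen (t n)) ∧ A ⊆ ⋃ n, t n ∧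
    ∑' n, ediam (t n) ^ (s : ℝ) < η

section SmallCover

variable {X : Type*} [MetricSpace X] {s : NNReal} {η : ENNReal} {A B : Set X}

theorem HasSmallCover.mono (h : HasSmallCover s η B) (hAB : A ⊆ B) : HasSmallCover s η A := by
  obtain ⟨t, ho, hB, hs⟩ := h
  exact ⟨t, ho, hAB.trans hB, hs⟩

theorem HasSmallCover.exists_isOpen (h : HasSmallCover s η A) :
    ∃ V, IsOpen V ∧ A ⊆ V ∧ HasSmallCover s η V := by
  obtain ⟨t, ho, hA, hs⟩ := h
  exact ⟨⋃ n, t n, isOpen_iUnion ho, hA, t, ho, Subset.rfl, hs⟩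

theorem HasSmallCover.union_isOpen {η' : ENNReal} {U : Set X} (h : HasSmallCover s η A)
    (hU : IsOpen U) (hη : ediam U ^ (s : ℝ) < η') : HasSmallCover s (η' + η) (A ∪ U) := by
  obtain ⟨t, ho, hA, hs⟩ := h
  refine ⟨fun n => Nat.casesOn n U t, ?_, ?_, ?_⟩
  · rintro (_ | n)
    exacts [hU, ho n]
  · rintro x (hx | hx)
    · obtain ⟨n, hn⟩ := mem_iUnion.1 (hA hx)
      exact mem_iUnion.2 ⟨n + 1, hn⟩
    · exact mem_iUnion.2 ⟨0, hx⟩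
  · rw [tsum_eq_zero_add' ENNReal.summable]
    exact ENNReal.add_lt_add hη hs

/-- A set can be enlarged to an open set with only a small increase of its `s`-size. -/
theorem exists_isOpen_superset_ediam_rpow_le (s : NNReal) (hA : ediam A ≠ ⊤) (hη : 0 < η) :
    ∃ U, IsOpen U ∧ A ⊆ U ∧ ediam U ^ (s : ℝ) ≤ ediam A ^ (s : ℝ) + η := by
  have hlt : ediam A ^ (s : ℝ) < ediam A ^ (s : ℝ) + η :=
    ENNReal.lt_add_right (ENNReal.rpow_ne_top_of_nonneg s.2 hA) hη.ne'
  have hc : Filter.Tendsto (fun ρ : NNReal => (ediam A + 2 * (ρ : ENNReal)) ^ (s : ℝ))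
      (𝓝 0) (𝓝 (ediam A ^ (s : ℝ))) := by
    have h2 : Continuous fun ρ : NNReal => (ediam A + 2 * (ρ : ENNReal)) ^ (s : ℝ) :=
      ENNReal.continuous_rpow_const.comp
        (continuous_const.add ((ENNReal.continuous_const_mul (by simp)).comp
          ENNReal.continuous_coe))
    simpa using h2.tendsto 0
  have hev := (hc.eventually (gt_mem_nhds hlt)).filter_mono
    (nhdsWithin_le_nhds (s := Ioi (0 : NNReal)))
  obtain ⟨ρ, hρ, hρ0⟩ := (hev.and self_mem_nhdsWithin).exists
  refine ⟨thickening ρ A, isOpen_thickening, self_subset_thickening hρ0 A, ?_⟩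
  exact (ENNReal.rpow_le_rpow (ediam_thickening_le ρ) s.2).trans hρ.le

theorem hasSmallCover_of_hausdorffMeasure_eq_zero [MeasurableSpace X] [BorelSpace X]
    (hs : 0 < s) (hη : 0 < η) (hA : μH[s] A = 0) : HasSmallCover s η A := by
  obtain ⟨η', hη'0, hη'⟩ := exists_between hη
  obtain ⟨t, hAt, ht, hsum⟩ : ∃ t : ℕ → Set X, A ⊆ ⋃ n, t n ∧ (∀ n, ediam (t n) ≤ 1) ∧
      ∑' n, ⨆ _ : (t n).Nonempty, ediam (t n) ^ (s : ℝ) < η' := by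
    have h0 : ⨅ (t : ℕ → Set X) (_ : A ⊆ ⋃ n, t n) (_ : ∀ n, ediam (t n) ≤ 1),
        ∑' n, ⨆ _ : (t n).Nonempty, ediam (t n) ^ (s : ℝ) < η' := by
      refine lt_of_le_of_lt ?_ hη'0
      rw [← hA, Measure.hausdorffMeasure_apply]
      exact le_iSup₂ (f := fun (r : ENNReal) (_ : 0 < r) => ⨅ (t : ℕ → Set X)
        (_ : A ⊆ ⋃ n, t n) (_ : ∀ n, ediam (t n) ≤ r),
        ∑' n, ⨆ _ : (t n).Nonempty, ediam (t n) ^ (s : ℝ)) 1 one_pos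
    simpa only [iInf_lt_iff, exists_prop] using h0
  have hsimp : ∀ n, ⨆ _ : (t n).Nonempty, ediam (t n) ^ (s : ℝ) = ediam (t n) ^ (s : ℝ) := by
    intro n
    rcases (t n).eq_empty_or_nonempty with h | h
    · simp [h, hs]
    · simp [h]
  simp only [hsimp] at hsum
  obtain ⟨ε, hε, hεsum⟩ := ENNReal.exists_pos_sum_of_countable (tsub_pos_of_lt hη').ne' ℕ
  choose U hUo hAU hU using fun n => exists_isOpen_superset_ediam_rpow_le s
    (ne_top_of_le_ne_top ENNReal.one_ne_top (ht n)) (ENNReal.coe_pos.2 (hε n))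
  refine ⟨U, hUo, hAt.trans (iUnion_mono hAU), ?_⟩
  calc ∑' n, ediam (U n) ^ (s : ℝ)
      ≤ ∑' n, (ediam (t n) ^ (s : ℝ) + ε n) := ENNReal.tsum_le_tsum hU
    _ = ∑' n, ediam (t n) ^ (s : ℝ) + ∑' n, (ε n : ENNReal) := ENNReal.tsum_add
    _ < η' + (η - η') := ENNReal.add_lt_add hsum hεsum
    _ = η := add_tsub_cancel_of_le hη'.le

theorem dimH_le_of_hasSmallCover (hs : 0 < s)
    (h : ∀ n : ℕ, HasSmallCover s ((n : ENNReal) + 1)⁻¹ A) : dimH A ≤ s := by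
  borelize X
  choose t _ hA hsum using h
  have hs' : (0 : ℝ) < s := hs
  have hlim : Filter.Tendsto (fun n : ℕ => ((n : ENNReal) + 1)⁻¹) Filter.atTop (𝓝 0) := by
    simpa using (Filter.tendsto_add_atTop_iff_nat 1).2 ENNReal.tendsto_inv_nat_nhds_zero
  refine dimH_le_of_hausdorffMeasure_ne_top (ne_top_of_le_ne_top ENNReal.zero_ne_top ?_)
  refine (Measure.hausdorffMeasure_le_liminf_tsum (l := Filter.atTop) s A
    (fun n : ℕ => (((n : ENNReal) + 1)⁻¹) ^ (s : ℝ)⁻¹) ?_ t (.of_forall fun n i => ?_)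
    (.of_forall hA)).trans ?_
  · have := hlim.ennrpow_const (s : ℝ)⁻¹
    rwa [ENNReal.zero_rpow_of_pos (inv_pos.2 hs')] at this
  · rw [ENNReal.le_rpow_inv_iff hs']
    exact (ENNReal.le_tsum i).trans (hsum n).le
  · rw [← hlim.liminf_eq]
    exact Filter.liminf_le_liminf (.of_forall fun n => (hsum n).le)

end SmallCover

/-- Tietze extension, relative to a given function `f` on the whole space. -/
theorem exists_continuousMap_dist_le_of_isClosedEmbedding {X K : Type*} [TopologicalSpace X]
    [CompactSpace X] [MetricSpace K] [CompactSpace K] {e : X → K} (he : IsClosedEmbedding e)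
    (f : C(K, ℝ)) (g : C(X, ℝ)) {ε : ℝ} (hε : 0 ≤ ε) (h : ∀ x, |g x - f (e x)| ≤ ε) :
    ∃ F : C(K, ℝ), dist F f ≤ ε ∧ ∀ x, F (e x) = g x := by
  obtain ⟨H, hH, hHe⟩ := BoundedContinuousFunction.exists_extension_norm_eq_of_isClosedEmbedding
    (BoundedContinuousFunction.mkOfCompact (g - f.comp ⟨e, he.continuous⟩)) he
  refine ⟨f + H.toContinuousMap, ?_, fun x => ?_⟩
  · rw [ContinuousMap.dist_le hε]
    intro x
    have h1 : ‖H x‖ ≤ ε := (H.norm_coe_le_norm x).trans <| hH ▸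
      (BoundedContinuousFunction.norm_le hε).2 fun x => by simpa using! h x
    simpa [Real.dist_eq] using h1
  · have := congrFun hHe x
    simp only [Function.comp_apply, BoundedContinuousFunction.mkOfCompact_apply,
      ContinuousMap.sub_apply, ContinuousMap.comp_apply, ContinuousMap.coe_mk] at this
    simp [this]

theorem exists_injective_abs_sub_le {ι : Type*} [Finite ι] (w : ι → ℝ) {ε : ℝ} (hε : 0 < ε) :
    ∃ v : ι → ℝ, Function.Injective v ∧ ∀ i, |v i - w i| ≤ ε := by
  obtain ⟨n, ⟨e⟩⟩ := Finite.exists_equiv_fin ι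
  have hu : ∀ i, 0 ≤ (e i : ℝ) / n ∧ (e i : ℝ) / n < 1 := fun i => by
    have h : ((e i : ℕ) : ℝ) < n := by exact_mod_cast (e i).2
    exact ⟨by positivity, (div_lt_one (by positivity [(Nat.cast_nonneg (e i : ℕ)).trans_lt h])).2 h⟩
  refine ⟨fun i => ε * (⌊w i / ε⌋ + (e i : ℝ) / n), fun i j hij => ?_, fun i => ?_⟩
  · have h1 := congrArg Int.fract (mul_left_cancel₀ hε.ne' hij)
    simp only [Int.fract_intCast_add, Int.fract_eq_self.2 (hu _)] at h1
    have hn : (n : ℝ) ≠ 0 := by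
      have := (e i).pos
      positivity
    rw [div_left_inj' hn] at h1
    exact e.injective (Fin.ext (by exact_mod_cast h1))
  · have h1 : w i = ε * (⌊w i / ε⌋ + Int.fract (w i / ε)) := by
      rw [Int.floor_add_fract]
      field_simp
    have h2 : ε * (⌊w i / ε⌋ + (e i : ℝ) / n) - w i
        = ε * ((e i : ℝ) / n - Int.fract (w i / ε)) := by
      linear_combination -h1
    rw [h2, abs_mul, abs_of_pos hε]
    refine mul_le_of_le_one_right hε.le (abs_le.2 ⟨?_, ?_⟩) <;>
    linarith [hu i, Int.fract_nonneg (w i / ε), Int.fract_lt_one (w i / ε)]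

theorem exists_pos_closedBall_separated {K ι : Type*} [MetricSpace K] [Finite ι] {x : ι → K}
    (hx : Function.Injective x) (f : C(K, ℝ)) {δ : ℝ} (hδ : 0 < δ) :
    ∃ r > 0, (∀ i j, i ≠ j → Disjoint (closedBall (x i) r) (closedBall (x j) r)) ∧
      ∀ i, ∀ z ∈ closedBall (x i) r, |f z - f (x i)| < δ := by
  have h1 : ∀ i j, i ≠ j → ∀ᶠ r in 𝓝[>] (0 : ℝ),
      Disjoint (closedBall (x i) r) (closedBall (x j) r) := fun i j hij => by
    filter_upwards [Ioo_mem_nhdsGT (half_pos (dist_pos.2 (hx.ne hij)))] with r hr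
    exact closedBall_disjoint_closedBall (by linarith [hr.2])
  have h2 : ∀ i, ∀ᶠ r in 𝓝[>] (0 : ℝ), ∀ z ∈ closedBall (x i) r, |f z - f (x i)| < δ := by
    intro i
    obtain ⟨ρ, hρ, hf⟩ := Metric.continuous_iff.1 f.continuous (x i) δ hδ
    filter_upwards [Ioo_mem_nhdsGT hρ] with r hr z hz
    exact hf z (lt_of_le_of_lt hz hr.2)
  obtain ⟨r, ⟨hr1, hr2⟩, hr⟩ := (((Filter.eventually_all.2 fun i => Filter.eventually_all.2
    fun j => Filter.eventually_imp_distrib_left.2 (h1 i j)).and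
    (Filter.eventually_all.2 h2)).and self_mem_nhdsWithin).exists
  exact ⟨r, hr, hr1, hr2⟩

section LevelSets

variable {K : Type*} [MetricSpace K] [CompactSpace K] {s : NNReal} {η : ENNReal}

theorem isOpen_setOf_hasSmallCover_preimage :
    IsOpen {p : C(K, ℝ) × ℝ | HasSmallCover s η (p.1 ⁻¹' {p.2})} := by
  refine isOpen_iff_mem_nhds.2 fun p hp => ?_
  obtain ⟨V, hVo, hpV, hV⟩ := HasSmallCover.exists_isOpen hp
  have hc : Continuous fun q : C(K, ℝ) × ℝ => q.1 - ContinuousMap.const K q.2 :=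
    continuous_fst.sub (ContinuousMap.continuous_const'.comp continuous_snd)
  have ho := (ContinuousMap.isOpen_setOfPred_mapsTo hVo.isClosed_compl.isCompact
    (isOpen_compl_singleton (x := (0 : ℝ)))).preimage hc
  refine Filter.mem_of_superset (ho.mem_nhds ?_) ?_
  · intro x hx h0
    exact hx (hpV (sub_eq_zero.1 h0))
  · intro q hq
    refine hV.mono fun x hx => ?_
    by_contra hxV
    exact hq hxV (sub_eq_zero.2 hx)

/-- If `K` has a basis whose members have boundaries of dimension less than `s`, then continuous
functions all of whose level sets have small `s`-size are dense. -/
theorem exists_dist_le_forall_hasSmallCover_preimage {𝒰 : Set (Set K)}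
    (h𝒰 : TopologicalSpace.IsTopologicalBasis 𝒰) (hs : 0 < s)
    (hfr : ∀ U ∈ 𝒰, dimH (frontier U) < s) (hη : 0 < η) (f : C(K, ℝ)) {ε : ℝ} (hε : 0 < ε) :
    ∃ g : C(K, ℝ), dist g f ≤ ε ∧ ∀ y, HasSmallCover s η (g ⁻¹' {y}) := by
  borelize K
  have hη2 : 0 < η / 2 := ENNReal.half_pos hη.ne'
  have hs' : (0 : ℝ) < s := hs
  have hU : ∀ x : K, ∃ U ∈ 𝒰, x ∈ U ∧ ediam U ^ (s : ℝ) < η / 2 ∧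
      ∀ z ∈ U, |f z - f x| < ε / 4 := by
    intro x
    obtain ⟨δ, hδ0, hδ⟩ := exists_between hη2
    obtain ⟨W, hWo, hxW, hW⟩ := exists_isOpen_superset_ediam_rpow_le s
      (A := {x}) (by simp) hδ0
    have hf : ∀ᶠ z in 𝓝 x, |f z - f x| < ε / 4 := by
      have := (f.continuous.tendsto x).eventually (Metric.ball_mem_nhds (f x) (by positivity :
        0 < ε / 4))
      simpa [Real.dist_eq] using this
    obtain ⟨U, hU, hxU, hUW⟩ := h𝒰.mem_nhds_iff.1
      (Filter.inter_mem (hWo.mem_nhds (singleton_subset_iff.1 hxW)) hf)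
    refine ⟨U, hU, hxU, ?_, fun z hz => (hUW hz).2⟩
    refine ((ENNReal.rpow_le_rpow (ediam_mono fun z hz => (hUW hz).1) s.2).trans hW).trans_lt ?_
    simpa [hs'] using hδ
  choose U hU𝒰 hxU hdiam hosc using hU
  have hUo : ∀ x, IsOpen (U x) := fun x => h𝒰.isOpen (hU𝒰 x)
  obtain ⟨t, ht⟩ := CompactSpace.elim_nhds_subcover U fun x => (hUo x).mem_nhds (hxU x)
  have hF : μH[s] (⋃ x ∈ t, frontier (U x)) = 0 :=
    (measure_biUnion_null_iff t.countable_toSet).2 fun x _ =>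
      hausdorffMeasure_of_dimH_lt (hfr _ (hU𝒰 x))
  obtain ⟨V, hVo, hFV, hV⟩ := (hasSmallCover_of_hausdorffMeasure_eq_zero hs hη2 hF).exists_isOpen
  have hcomp : CompactSpace ↥Vᶜ := isCompact_iff_compactSpace.1 hVo.isClosed_compl.isCompact
  let σ : ↥Vᶜ → Set t := fun z => {i | (z : K) ∈ U i}
  have hσ : IsLocallyConstant σ := by
    refine (IsLocallyConstant.iff_eventually_eq σ).2 fun z => ?_
    have : ∀ i : t, ∀ᶠ z' : ↥Vᶜ in 𝓝 z, ((z' : K) ∈ U i ↔ (z : K) ∈ U i) := by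
      intro i
      by_cases hz : (z : K) ∈ U i
      · filter_upwards [((hUo i).preimage continuous_subtype_val).mem_nhds hz] with z' hz'
        exact iff_of_true hz' hz
      · have hcl : (z : K) ∉ closure (U i) := fun hcl => z.2 <| hFV <|
          mem_iUnion₂.2 ⟨i, i.2, hcl, by rwa [(hUo i).interior_eq]⟩
        filter_upwards [(isClosed_closure.isOpen_compl.preimage
          continuous_subtype_val).mem_nhds hcl] with z' hz'
        exact iff_of_false (fun h => hz' (subset_closure h)) hz
    filter_upwards [Filter.eventually_all.2 this] with z' hz'
    exact Set.ext hz'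
  have hne : ∀ z, (σ z).Nonempty := fun z => by
    have : (z : K) ∈ ⋃ x ∈ t, U x := by rw [ht]; trivial
    obtain ⟨i, hi, hz⟩ := mem_iUnion₂.1 this
    exact ⟨⟨i, hi⟩, hz⟩
  obtain ⟨v, hv, hvw⟩ := exists_injective_abs_sub_le
    (fun a : Set t => if h : a.Nonempty then f h.some else 0) (half_pos hε)
  obtain ⟨g, hgf, hg⟩ := exists_continuousMap_dist_le_of_isClosedEmbedding
    hVo.isClosed_compl.isClosedEmbedding_subtypeVal f ⟨v ∘ σ, (hσ.comp v).continuous⟩ hε.le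
    (fun z => by
      have h1 := hvw (σ z)
      simp only [hne z, dif_pos] at h1
      have h2 := hosc _ z (hne z).some_mem
      simp only [ContinuousMap.coe_mk, Function.comp_apply]
      rw [abs_lt] at h2
      rw [abs_le] at h1 ⊢
      constructor <;> linarith)
  refine ⟨g, hgf, fun y => ?_⟩
  obtain ⟨W, hWo, hW, hyW⟩ : ∃ W, IsOpen W ∧ ediam W ^ (s : ℝ) < η / 2 ∧
      g ⁻¹' {y} ⊆ V ∪ W := by
    by_cases hy : ∃ z : ↥Vᶜ, g z = y
    · obtain ⟨z, rfl⟩ := hy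
      obtain ⟨i, hi⟩ := hne z
      refine ⟨U i, hUo i, hdiam i, fun z' hz' => or_iff_not_imp_left.2 fun hV' => ?_⟩
      have : σ ⟨z', hV'⟩ = σ z := hv <| (hg ⟨z', hV'⟩).symm.trans ((show g z' = g z from hz').trans (hg z))
      exact (this ▸ hi : i ∈ σ ⟨z', hV'⟩)
    · refine ⟨∅, isOpen_empty, by simpa [hs'] using hη.ne', fun z hz => ?_⟩
      exact Or.inl (by_contra fun hV' => hy ⟨⟨z, hV'⟩, hz⟩)
  have := (hV.union_isOpen hWo hW).mono hyW
  rwa [ENNReal.add_halves] at this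

theorem residual_forall_dimH_preimage_le {𝒰 : Set (Set K)}
    (h𝒰 : TopologicalSpace.IsTopologicalBasis 𝒰) (hs : 0 < s)
    (hfr : ∀ U ∈ 𝒰, dimH (frontier U) < s) :
    {f : C(K, ℝ) | ∀ y, dimH (f ⁻¹' {y}) ≤ s} ∈ residual C(K, ℝ) := by
  have key : ∀ N n : ℕ, {f : C(K, ℝ) | ∀ y ∈ Icc (-N : ℝ) N,
      HasSmallCover s ((n : ENNReal) + 1)⁻¹ (f ⁻¹' {y})} ∈ residual C(K, ℝ) := by
    intro N n
    refine residual_of_dense_open (isOpen_iff_mem_nhds.2 fun f hf => ?_) fun f => ?_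
    · exact isCompact_Icc.eventually_forall_of_forall_eventually fun y hy =>
        isOpen_setOf_hasSmallCover_preimage.mem_nhds (hf y hy)
    · refine Metric.mem_closure_iff.2 fun ε hε => ?_
      obtain ⟨g, hg, hcov⟩ := exists_dist_le_forall_hasSmallCover_preimage h𝒰 hs hfr
        (η := ((n : ENNReal) + 1)⁻¹) (by simp) f (half_pos hε)
      exact ⟨g, fun y _ => hcov y, by rw [dist_comm]; linarith⟩
  filter_upwards [eventually_countable_forall.2 fun N => eventually_countable_forall.2 (key N)]
    with f hf y
  obtain ⟨N, hN⟩ := exists_nat_ge |y|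
  exact dimH_le_of_hasSmallCover hs fun n => hf N n y (abs_le.1 hN)

/-- If the open sets with boundary of dimension at most `s` do not form a basis, then all functions
close to a suitable one have a zero set of dimension at least `s`. -/
theorem exists_forall_dist_lt_le_dimH_preimage (hs : 0 < s)
    (h : ¬ TopologicalSpace.IsTopologicalBasis {U : Set K | IsOpen U ∧ dimH (frontier U) ≤ s}) :
    ∃ f : C(K, ℝ), ∃ ε > 0, ∀ g : C(K, ℝ), dist g f < ε → s ≤ dimH (g ⁻¹' {0}) := by
  borelize K
  contrapose! h
  have hd : Dense (⋂ n : ℕ, {p : C(K, ℝ) × ℝ |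
      HasSmallCover s ((n : ENNReal) + 1)⁻¹ (p.1 ⁻¹' {p.2})}) := by
    refine dense_iInter_of_isOpen_nat (fun n => isOpen_setOf_hasSmallCover_preimage) fun n => ?_
    rintro ⟨f, y⟩
    refine Metric.mem_closure_iff.2 fun ε hε => ?_
    obtain ⟨g, hg, hdim⟩ := h (f - ContinuousMap.const K y) ε hε
    refine ⟨(g + ContinuousMap.const K y, y), ?_, ?_⟩
    · have : (g + ContinuousMap.const K y) ⁻¹' {y} = g ⁻¹' {0} := by
        ext x
        simp
      simp only [mem_ofPred_eq, this]
      exact hasSmallCover_of_hausdorffMeasure_eq_zero hs (by simp)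
        (hausdorffMeasure_of_dimH_lt hdim)
    · rw [Prod.dist_eq, dist_self, max_eq_left dist_nonneg, dist_comm, dist_eq_norm]
      rwa [dist_eq_norm, sub_sub_eq_add_sub] at hg
  refine TopologicalSpace.isTopologicalBasis_of_isOpen_of_nhds (fun U hU => hU.1) ?_
  intro x W hx hW
  obtain ⟨r, hr, hrW⟩ := Metric.isOpen_iff.1 hW x hx
  let F : C(K, ℝ) := ⟨fun z => dist z x, by fun_prop⟩
  obtain ⟨⟨f, y⟩, hfy, hclose⟩ := Metric.dense_iff.1 hd (F, r / 2) (r / 4) (by positivity)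
  rw [Metric.mem_ball, Prod.dist_eq, max_lt_iff] at hfy
  have hf : ∀ z, |f z - dist z x| < r / 4 := fun z =>
    (ContinuousMap.dist_apply_le_dist z).trans_lt hfy.1
  have hy : |y - r / 2| < r / 4 := hfy.2
  rw [abs_lt] at hy
  refine ⟨{z | f z < y}, ⟨isOpen_lt f.continuous continuous_const, ?_⟩, ?_, fun z hz => hrW ?_⟩
  · refine (dimH_mono (frontier_lt_subset_eq f.continuous continuous_const)).trans ?_
    exact dimH_le_of_hasSmallCover hs (mem_iInter.1 hclose)
  · have := abs_lt.1 (hf x)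
    rw [dist_self] at this
    simp only [mem_ofPred_eq]
    linarith
  · have := abs_lt.1 (hf z)
    simp only [mem_ofPred_eq] at hz
    rw [Metric.mem_ball]
    linarith

theorem isOpen_setOf_notMem_range (y : ℝ) : IsOpen {f : C(K, ℝ) | y ∉ range f} := by
  convert ContinuousMap.isOpen_setOfPred_mapsTo (X := K) isCompact_univ
    (isOpen_compl_singleton (x := y)) using 1
  ext f
  simp [MapsTo]

/-- Placing small scaled copies of `f₁` in small copies of `K` forces large level sets. -/
theorem exists_dist_lt_eventually_le_dimH_preimage
    (hself : ∀ (x : K) (r : ℝ), 0 < r → ∃ ψ : K → K, Continuous ψ ∧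
      (∃ L, AntilipschitzWith L ψ) ∧ ∀ k, ψ k ∈ closedBall x r)
    {f₁ : C(K, ℝ)} {ε : ℝ} (hε : 0 < ε)
    (hf₁ : ∀ g : C(K, ℝ), dist g f₁ < ε → s ≤ dimH (g ⁻¹' {0}))
    {p q : ℝ} {f : C(K, ℝ)} (hpq : Icc p q ⊆ range f) {δ : ℝ} (hδ : 0 < δ) :
    ∃ F : C(K, ℝ), dist F f < δ ∧
      ∀ᶠ h : C(K, ℝ) in 𝓝 F, ∀ y ∈ Icc p q, s ≤ dimH (h ⁻¹' {y}) := by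
  obtain ⟨c, hc, hcf⟩ : ∃ c > 0, c * ‖f₁‖ ≤ δ / 4 := by
    refine ⟨δ / 4 / (‖f₁‖ + 1), by positivity, ?_⟩
    rw [div_mul_eq_mul_div, div_le_iff₀ (by positivity)]
    nlinarith [norm_nonneg f₁]
  obtain ⟨t, htI, htf, hcov⟩ := finite_cover_balls_of_compact (isCompact_Icc (a := p) (b := q))
    (e := c * ε / 2) (by positivity)
  have : Finite t := htf
  choose x hx using fun v : t => hpq (htI v.2)
  have hxinj : Function.Injective x := fun v w hvw => Subtype.ext <| by rw [← hx, ← hx, hvw]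
  obtain ⟨r, hr, hdisj, hosc⟩ := exists_pos_closedBall_separated hxinj f
    (show 0 < δ / 4 by positivity)
  choose ψ hψc hψL hψ using fun v : t => hself (x v) r hr
  let e : (Σ _ : t, K) → K := fun a => ψ a.1 a.2
  have hec : Continuous e := continuous_sigma hψc
  have heinj : Function.Injective e := by
    rintro ⟨v, k⟩ ⟨w, k'⟩ (h : ψ v k = ψ w k')
    by_cases hvw : v = w
    · subst hvw
      obtain ⟨L, hL⟩ := hψL v
      rw [hL.injective h]
    · exact (disjoint_left.1 (hdisj v w hvw) (hψ v k) (h ▸ hψ w k')).elim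
  obtain ⟨F, hFf, hF⟩ := exists_continuousMap_dist_le_of_isClosedEmbedding
    (hec.isClosedEmbedding heinj) f
    ⟨fun a => (a.1 : ℝ) + c * f₁ a.2, continuous_sigma fun v => by fun_prop⟩
    (ε := δ / 2) (by positivity) (by
      rintro ⟨v, k⟩
      have h1 := abs_lt.1 (hosc v _ (hψ v k))
      rw [hx] at h1
      have h2 : |c * f₁ k| ≤ δ / 4 := by
        rw [abs_mul, abs_of_pos hc]
        exact (mul_le_mul_of_nonneg_left (f₁.norm_coe_le_norm k) hc.le).trans hcf
      rw [abs_le] at h2 ⊢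
      simp only [ContinuousMap.coe_mk, e]
      constructor <;> linarith)
  refine ⟨F, by linarith, ?_⟩
  filter_upwards [Metric.ball_mem_nhds F (show 0 < c * ε / 2 by positivity)] with h hh y hy
  obtain ⟨v, hv, hyv⟩ := mem_iUnion₂.1 (hcov hy)
  let w : t := ⟨v, hv⟩
  let G : C(K, ℝ) := ⟨fun k => c⁻¹ * (h (ψ w k) - y), by
    have := hψc w
    fun_prop⟩
  have hG : dist G f₁ < ε := by
    rw [ContinuousMap.dist_lt_iff hε]
    intro k
    have h1 : |h (ψ w k) - F (ψ w k)| < c * ε / 2 :=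
      (ContinuousMap.dist_apply_le_dist _).trans_lt hh
    have h2 : |y - v| < c * ε / 2 := hyv
    have h3 : F (ψ w k) = v + c * f₁ k := hF ⟨w, k⟩
    have h4 : G k - f₁ k = c⁻¹ * ((h (ψ w k) - F (ψ w k)) - (y - v)) := by
      simp only [G, ContinuousMap.coe_mk, h3]
      field_simp
      ring
    rw [Real.dist_eq, h4, abs_mul, abs_of_pos (inv_pos.2 hc), inv_mul_lt_iff₀ hc]
    exact (abs_sub _ _).trans_lt (by linarith)
  obtain ⟨L, hL⟩ := hψL w
  refine (hf₁ G hG).trans (le_of_eq_of_le ?_ (hL.dimH_preimage_le (h ⁻¹' {y})))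
  congr 1
  ext k
  simp [G, hc.ne', sub_eq_zero]

theorem residual_forall_mem_interior_range_le_dimH_preimage (hs : 0 < s)
    (hself : ∀ (x : K) (r : ℝ), 0 < r → ∃ ψ : K → K, Continuous ψ ∧
      (∃ L, AntilipschitzWith L ψ) ∧ ∀ k, ψ k ∈ closedBall x r)
    (h : ¬ TopologicalSpace.IsTopologicalBasis {U : Set K | IsOpen U ∧ dimH (frontier U) ≤ s}) :
    {f : C(K, ℝ) | ∀ y ∈ interior (range f), s ≤ dimH (f ⁻¹' {y})} ∈ residual C(K, ℝ) := by
  obtain ⟨f₁, ε, hε, hf₁⟩ := exists_forall_dist_lt_le_dimH_preimage hs h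
  have key : ∀ p q : ℚ, {f : C(K, ℝ) | Icc (p : ℝ) q ⊆ range f →
      ∀ y ∈ Icc (p : ℝ) q, s ≤ dimH (f ⁻¹' {y})} ∈ residual C(K, ℝ) := by
    intro p q
    let O : Set C(K, ℝ) := (⋃ y ∈ Icc (p : ℝ) q, {f : C(K, ℝ) | y ∉ range f}) ∪
      interior {f : C(K, ℝ) | ∀ y ∈ Icc (p : ℝ) q, s ≤ dimH (f ⁻¹' {y})}
    have hO : IsOpen O := (isOpen_biUnion fun y _ => isOpen_setOf_notMem_range y).union
      isOpen_interior
    have hOd : Dense O := fun f => Metric.mem_closure_iff.2 fun δ hδ => by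
      by_cases hf : Icc (p : ℝ) q ⊆ range f
      · obtain ⟨F, hF, hev⟩ :=
          exists_dist_lt_eventually_le_dimH_preimage hself hε hf₁ hf hδ
        exact ⟨F, Or.inr (mem_interior_iff_mem_nhds.2 hev), by rwa [dist_comm]⟩
      · obtain ⟨y, hy, hyf⟩ := not_subset.1 hf
        exact ⟨f, Or.inl (mem_iUnion₂.2 ⟨y, hy, hyf⟩), by rwa [dist_self]⟩
    filter_upwards [residual_of_dense_open hO hOd] with f hf hpq
    rcases hf with hf | hf
    · obtain ⟨y, hy, hyf⟩ := mem_iUnion₂.1 hf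
      exact absurd (hpq hy) hyf
    · exact interior_subset hf
  filter_upwards [eventually_countable_forall.2 fun p => eventually_countable_forall.2 (key p)]
    with f hf y hy
  obtain ⟨a, b, hyab, hab⟩ := mem_nhds_iff_exists_Ioo_subset.1 (mem_interior_iff_mem_nhds.1 hy)
  obtain ⟨p, hp⟩ := exists_rat_btwn hyab.1
  obtain ⟨q, hq⟩ := exists_rat_btwn hyab.2
  exact hf p q ((Icc_subset_Ioo hp.1 hq.2).trans hab) y ⟨hp.2.le, hq.1.le⟩

theorem residual_interior_range_eq_empty {𝒰 : Set (Set K)}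
    (h𝒰 : TopologicalSpace.IsTopologicalBasis 𝒰) (hfr : ∀ U ∈ 𝒰, frontier U = ∅) :
    {f : C(K, ℝ) | interior (range f) = ∅} ∈ residual C(K, ℝ) := by
  have key : ∀ y : ℚ, {f : C(K, ℝ) | (y : ℝ) ∉ range f} ∈ residual C(K, ℝ) := by
    intro y
    refine residual_of_dense_open (isOpen_setOf_notMem_range _) fun f => ?_
    refine Metric.mem_closure_iff.2 fun ε hε => ?_
    have hU : ∀ x ∈ {x | (y : ℝ) ≤ f x}, ∃ U ∈ 𝒰, x ∈ U ∧ U ⊆ {x | (y : ℝ) - ε / 2 < f x} :=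
      fun x (hx : (y : ℝ) ≤ f x) => h𝒰.mem_nhds_iff.1 <|
        (isOpen_lt continuous_const f.continuous).mem_nhds (by
          simp only [mem_ofPred_eq]
          linarith)
    choose! U hU𝒰 hxU hUf using hU
    obtain ⟨t, ht, hcov⟩ := (isClosed_le continuous_const f.continuous).isCompact.elim_nhds_subcover
      U fun x hx => (h𝒰.isOpen (hU𝒰 x hx)).mem_nhds (hxU x hx)
    have hC : IsClopen (⋃ x ∈ t, U x) := isClopen_biUnion_finset fun x hx =>
      isClopen_iff_frontier_eq_empty.2 (hfr _ (hU𝒰 x (ht x hx)))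
    have hCf : ∀ x ∈ ⋃ x ∈ t, U x, (y : ℝ) - ε / 2 < f x := fun x hx => by
      obtain ⟨z, hz, hxz⟩ := mem_iUnion₂.1 hx
      exact hUf z (ht z hz) hxz
    let g : C(K, ℝ) := ⟨fun x => if x ∈ ⋃ x ∈ t, U x then f x + ε / 2 else f x - ε / 2,
      Continuous.if (fun a ha => by
        have : a ∈ frontier (⋃ x ∈ t, U x) := ha
        simp [hC.frontier_eq] at this) (by fun_prop) (by fun_prop)⟩
    refine ⟨g, ?_, ?_⟩
    · rintro ⟨x, hx⟩
      simp only [g, ContinuousMap.coe_mk] at hx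
      split_ifs at hx with hxC
      · linarith [hCf x hxC]
      · have : f x < y := not_le.1 fun h => hxC (hcov h)
        linarith
    · rw [ContinuousMap.dist_lt_iff hε]
      intro x
      simp only [g, ContinuousMap.coe_mk, Real.dist_eq]
      rw [abs_lt]
      split_ifs <;> constructor <;> linarith
  filter_upwards [eventually_countable_forall.2 key] with f hf
  refine eq_empty_of_forall_notMem fun y hy => ?_
  obtain ⟨a, b, hyab, hab⟩ := mem_nhds_iff_exists_Ioo_subset.1 (mem_interior_iff_mem_nhds.1 hy)
  obtain ⟨p, hp⟩ := exists_rat_btwn (hyab.1.trans hyab.2)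
  exact hf p (hab hp)

end LevelSets

section TopologicalHausdorffDimension

theorem hdim_of_nonempty {X : Type*} [EMetricSpace X] {A : Set X} (hA : A.Nonempty) :
    hdim A = (dimH A : EReal) :=
  if_neg hA.ne_empty

theorem hdim_le_iff {X : Type*} [EMetricSpace X] {A : Set X} {s : NNReal} :
    hdim A ≤ ((s : ENNReal) : EReal) ↔ dimH A ≤ s := by
  rcases A.eq_empty_or_nonempty with rfl | hA
  · have : (-1 : EReal) ≤ ((s : ENNReal) : EReal) :=
      le_trans (by norm_num : (-1 : EReal) ≤ 0) (EReal.coe_ennreal_nonneg _)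
    simp [hdim, this]
  · rw [hdim_of_nonempty hA, EReal.coe_ennreal_le_coe_ennreal_iff]

variable {K : Type*} [MetricSpace K] [Nonempty K]

theorem exists_basis_hdim_frontier_lt {c : ℝ} (h : tHdim K - 1 < c) :
    ∃ 𝒰 : Set (Set K), TopologicalSpace.IsTopologicalBasis 𝒰 ∧
      ∀ U ∈ 𝒰, hdim (frontier U) < c := by
  have h1 : tHdim K < c + 1 :=
    (EReal.sub_lt_iff (.inl (EReal.coe_ne_bot 1)) (.inl (EReal.coe_ne_top 1))).1 h
  rw [tHdim, if_pos ‹_›, sInf_lt_iff] at h1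
  obtain ⟨d, ⟨𝒰, h𝒰, hd⟩, hdc⟩ := h1
  exact ⟨𝒰, h𝒰, fun U hU => (hd U hU).trans_lt (EReal.sub_lt_of_lt_add hdc)⟩

theorem not_isTopologicalBasis_of_lt_tHdim {s : NNReal}
    (h : ((s : ENNReal) : EReal) < tHdim K - 1) :
    ¬ TopologicalSpace.IsTopologicalBasis {U : Set K | IsOpen U ∧ dimH (frontier U) ≤ s} := by
  intro hb
  refine h.not_ge (EReal.sub_le_of_le_add ?_)
  rw [tHdim, if_pos ‹_›]
  refine sInf_le ⟨_, hb, fun U hU => ?_⟩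
  have : ((s : ENNReal) : EReal) + 1 - 1 = ((s : ENNReal) : EReal) := by
    have := EReal.add_sub_cancel_right (a := ((s : ENNReal) : EReal)) (b := 1)
    simpa using this
  rw [this]
  exact hdim_le_iff.2 hU.2

end TopologicalHausdorffDimension

theorem exists_continuous_antilipschitz_of_bijective {K : Type*} [MetricSpace K] {K' : Set K}
    {φ : K' → K} {L L' : NNReal} (hφ : Function.Bijective φ) (hL : LipschitzWith L φ)
    (hL' : AntilipschitzWith L' φ) :
    ∃ ψ : K → K, Continuous ψ ∧ (∃ M, AntilipschitzWith M ψ) ∧ ∀ k, ψ k ∈ K' := by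
  let e := Equiv.ofBijective φ hφ
  have hr : Function.RightInverse e.symm φ := e.apply_symm_apply
  refine ⟨fun k => e.symm k, continuous_subtype_val.comp (hL'.to_rightInverse hr).continuous,
    ⟨L, ?_⟩, fun k => (e.symm k).2⟩
  exact hL.to_rightInverse hr

/-- Let `K` be a weakly self-similar compact metric space (for every `x ∈ K`
and `r > 0` there are a compact set `K' ⊆ B(x,r)` and a bi-Lipschitz bijection `φ : K' → K`).
Then for the generic `f ∈ C(K)`, for every `y` in the interior of `f(K)` one has
`dim_H f⁻¹(y) = dim_tH K − 1`. -/
theorem generic_level_dimension_of_weaklySelfSimilar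
    {K : Type*} [MetricSpace K] [CompactSpace K]
    (hws : ∀ (x : K) (r : ℝ), 0 < r → ∃ K' : Set K, IsCompact K' ∧ K' ⊆ closedBall x r ∧
      ∃ (φ : K' → K) (L L' : NNReal), Function.Bijective φ ∧
        LipschitzWith L φ ∧ AntilipschitzWith L' φ) :
    {f : C(K, ℝ) | ∀ y ∈ interior (Set.range ⇑f), hdim (⇑f ⁻¹' {y}) = tHdim K - 1} ∈
      residual C(K, ℝ) := by
  rcases isEmpty_or_nonempty K with hK | hK
  · exact Filter.univ_mem' fun f y hy => (interior_subset hy).elim fun x _ => hK.elim x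
  have hself : ∀ (x : K) (r : ℝ), 0 < r → ∃ ψ : K → K, Continuous ψ ∧
      (∃ L, AntilipschitzWith L ψ) ∧ ∀ k, ψ k ∈ closedBall x r := by
    intro x r hr
    obtain ⟨K', -, hK', φ, L, L', hφ, hL, hL'⟩ := hws x r hr
    obtain ⟨ψ, hc, hM, hψ⟩ := exists_continuous_antilipschitz_of_bijective hφ hL hL'
    exact ⟨ψ, hc, hM, fun k => hK' (hψ k)⟩
  rcases lt_or_ge (tHdim K - 1) 0 with hT | hT
  · obtain ⟨𝒰, h𝒰, hfr⟩ := exists_basis_hdim_frontier_lt (K := K) (c := 0) (by simpa using hT)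
    filter_upwards [residual_interior_range_eq_empty h𝒰 fun U hU => by
      by_contra hne
      have := hfr U hU
      rw [hdim_of_nonempty (nonempty_iff_ne_empty.2 hne)] at this
      exact this.not_ge (EReal.coe_ennreal_nonneg _)] with f hf y hy
    simp [hf] at hy
  obtain ⟨D, hD⟩ : ∃ D : ENNReal, tHdim K - 1 = D :=
    ⟨_, (EReal.coe_toENNReal hT).symm⟩
  have hupper : ∀ s : ℚ, D < (Real.toNNReal s : ENNReal) →
      {f : C(K, ℝ) | ∀ y, dimH (f ⁻¹' {y}) ≤ Real.toNNReal s} ∈ residual C(K, ℝ) := by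
    intro s hs
    have hs0 : 0 < Real.toNNReal s := ENNReal.coe_pos.1 (bot_le.trans_lt hs)
    obtain ⟨𝒰, h𝒰, hfr⟩ := exists_basis_hdim_frontier_lt (K := K) (c := Real.toNNReal s)
      (hD ▸ EReal.coe_ennreal_lt_coe_ennreal_iff.2 hs)
    refine residual_forall_dimH_preimage_le h𝒰 hs0 fun U hU => ?_
    rcases (frontier U).eq_empty_or_nonempty with he | hne
    · simpa [he] using hs0
    · have := hfr U hU
      rw [hdim_of_nonempty hne] at this
      exact EReal.coe_ennreal_lt_coe_ennreal_iff.1 this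
  have hlower : ∀ s : ℚ, (Real.toNNReal s : ENNReal) < D →
      {f : C(K, ℝ) | ∀ y ∈ interior (range f), Real.toNNReal s ≤ dimH (f ⁻¹' {y})} ∈
        residual C(K, ℝ) := by
    intro s hs
    rcases (bot_le (a := Real.toNNReal s)).eq_or_lt with h0 | h0
    · exact Filter.univ_mem' fun f y _ => by simp [← h0]
    · exact residual_forall_mem_interior_range_le_dimH_preimage h0 hself
        (not_isTopologicalBasis_of_lt_tHdim
          (hD ▸ EReal.coe_ennreal_lt_coe_ennreal_iff.2 hs))
  filter_upwards [eventually_countable_forall.2 fun s => eventually_countable_forall.2 (hupper s),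
    eventually_countable_forall.2 fun s => eventually_countable_forall.2 (hlower s)]
    with f hfu hfl y hy
  have hne : (f ⁻¹' {y}).Nonempty :=
    (interior_subset hy : y ∈ range f)
  rw [hdim_of_nonempty hne, hD, EReal.coe_ennreal_eq_coe_ennreal_iff]
  refine le_antisymm (le_of_not_gt fun h => ?_) (le_of_not_gt fun h => ?_)
  · obtain ⟨s, -, hDs, hs⟩ := ENNReal.lt_iff_exists_rat_btwn.1 h
    exact hs.not_ge (hfu s hDs y)
  · obtain ⟨s, -, hs, hsD⟩ := ENNReal.lt_iff_exists_rat_btwn.1 h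
    exact hs.not_ge (hfl s hsD y hy)
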